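/- arXiv:2211.06480 — 3 statements merged into one kernel-verified Lean document; each statement's English description precedes it below -/
import Mathlib

section
/- Let K be a field, G a subgroup of the unit group K^×, and a ∈ K. Let x : ι → K and y : κ → K be finite families. Suppose there exist g : ι → G and u ∈ G with ∑_i g_i·x_i + u·a = 0 in K, and there exist h : κ → G and w ∈ G with ∑_j h_j·y_j − w·a = 0 in K. Then there exist p : ι → G and q : κ → G with ∑_i p_i·x_i + ∑_j q_j·y_j = 0 in K. -/
/-- Fusion rule for quotient hyperfields `K/G`: if a family `x` together with `a` admits
representatives summing to zero, and a family `y` together with `-a` admits representatives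
summing to zero, then the combined family `x, y` admits representatives summing to zero. -/
theorem quotient_hyperfield_fusion
    {K : Type*} [Field K] (G : Subgroup Kˣ) {ι κ : Type*} [Fintype ι] [Fintype κ]
    (a : K) (x : ι → K) (y : κ → K)
    (h1 : ∃ (g : ι → G) (u : G), ∑ i, ((g i : Kˣ) : K) * x i + ((u : Kˣ) : K) * a = 0)
    (h2 : ∃ (h : κ → G) (w : G), ∑ j, ((h j : Kˣ) : K) * y j - ((w : Kˣ) : K) * a = 0) :
    ∃ (p : ι → G) (q : κ → G),
      ∑ i, ((p i : Kˣ) : K) * x i + ∑ j, ((q j : Kˣ) : K) * y j = 0 := by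
  obtain ⟨g, u, hg⟩ := h1
  obtain ⟨h, w, hh⟩ := h2
  refine ⟨fun i => w * g i, fun j => u * h j, ?_⟩
  simp only [Subgroup.coe_mul, Units.val_mul, mul_assoc, ← Finset.mul_sum]
  linear_combination ((w : Kˣ) : K) * hg + ((u : Kˣ) : K) * hh
end

section
/- Let K be an algebraically closed field, Γ₀ a linearly ordered commutative group with zero, and v : K → Γ₀ a valuation. Let f ∈ K[X] be a nonzero polynomial with coefficients c_i, and let γ ∈ Γ₀ with γ ≠ 0. Let S = {i ∈ supp(f) : v(c_j)·γʲ ≤ v(c_i)·γⁱ for all j ∈ supp(f)} be the set of indices maximizing v(c_i)·γⁱ (S is nonempty). Then the number of roots r of f in K, counted with multiplicity, satisfying v(r) = γ equals max S − min S. -/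
open Polynomial

section NPR
variable {K : Type*} [Field K] {Γ₀ : Type*} [LinearOrderedCommGroupWithZero Γ₀]

/-- weight of the `i`-th term -/
def nprU (v : Valuation K Γ₀) (γ : Γ₀) (p : K[X]) (i : ℕ) : Γ₀ := v (p.coeff i) * γ ^ i

/-- `a` and `b` are the first and last indices of maximal weight `M`. -/
def nprP (v : Valuation K Γ₀) (γ : Γ₀) (p : K[X]) (a b : ℕ) (M : Γ₀) : Prop :=
  0 < M ∧ (∀ i, nprU v γ p i ≤ M) ∧ nprU v γ p a = M ∧ nprU v γ p b = M ∧
    (∀ i, i < a → nprU v γ p i < M) ∧ (∀ i, b < i → nprU v γ p i < M)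

lemma npr_zero (v : Valuation K Γ₀) (γ : Γ₀) (p : K[X]) (r : K) :
    nprU v γ ((X - C r) * p) 0 = v r * nprU v γ p 0 := by
  simp [nprU, sub_mul, mul_coeff_zero]

lemma npr_coeff (p : K[X]) (r : K) (i : ℕ) :
    ((X - C r) * p).coeff (i+1) = p.coeff i - r * p.coeff (i+1) := by
  simp [sub_mul, coeff_X_mul]

lemma npr_e1 (v : Valuation K Γ₀) (γ : Γ₀) (p : K[X]) (i : ℕ) :
    γ * nprU v γ p i = v (p.coeff i) * γ ^ (i+1) := by
  simp only [nprU, pow_succ]; ac_rfl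

lemma npr_e2 (v : Valuation K Γ₀) (γ : Γ₀) (p : K[X]) (r : K) (i : ℕ) :
    v r * nprU v γ p i = v (r * p.coeff i) * γ ^ i := by
  simp only [nprU, map_mul]; ac_rfl

lemma npr_le (v : Valuation K Γ₀) (γ : Γ₀) (p : K[X]) (r : K) (i : ℕ) :
    nprU v γ ((X - C r) * p) (i+1) ≤ max (γ * nprU v γ p i) (v r * nprU v γ p (i+1)) := by
  rw [npr_e1, npr_e2, nprU, npr_coeff]
  rcases le_max_iff.1 (v.map_sub (p.coeff i) (r * p.coeff (i+1))) with h | h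
  · exact le_max_of_le_left (mul_le_mul_left h _)
  · exact le_max_of_le_right (mul_le_mul_left h _)

lemma npr_eq_r (v : Valuation K Γ₀) (γ : Γ₀) (p : K[X]) (r : K) (i : ℕ)
    (h : γ * nprU v γ p i < v r * nprU v γ p (i+1)) :
    nprU v γ ((X - C r) * p) (i+1) = v r * nprU v γ p (i+1) := by
  rw [npr_e1, npr_e2] at h
  rw [npr_e2, nprU, npr_coeff, Valuation.map_sub_eq_of_lt_right]
  exact lt_of_mul_lt_mul_right h zero_le

lemma npr_eq_l (v : Valuation K Γ₀) (γ : Γ₀) (p : K[X]) (r : K) (i : ℕ)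
    (h : v r * nprU v γ p (i+1) < γ * nprU v γ p i) :
    nprU v γ ((X - C r) * p) (i+1) = γ * nprU v γ p i := by
  rw [npr_e1, npr_e2] at h
  rw [npr_e1, nprU, npr_coeff, Valuation.map_sub_eq_of_lt_left]
  exact lt_of_mul_lt_mul_right h zero_le

lemma npr_m1 {a b u M : Γ₀} (h : a < b) (hu : u ≤ M) (hM : 0 < M) : a * u < b * M :=
  (mul_le_mul_right hu a).trans_lt (mul_lt_mul_of_pos_right h hM)

lemma npr_m2 {a b u M : Γ₀} (h : a ≤ b) (hu : u < M) (hb : 0 < b) : a * u < b * M :=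
  (mul_le_mul_left h u).trans_lt (mul_lt_mul_of_pos_left hu hb)

lemma npr_m3 {a b u M : Γ₀} (h : a ≤ b) (hu : u ≤ M) : a * u ≤ b * M :=
  mul_le_mul' h hu

lemma npr_lt (v : Valuation K Γ₀) (γ : Γ₀) (hγ : 0 < γ) (p : K[X]) (r : K) (a b : ℕ) (M : Γ₀)
    (h : nprP v γ p a b M) (hr : v r < γ) :
    nprP v γ ((X - C r) * p) (a+1) (b+1) (γ * M) := by
  obtain ⟨hM, hle, ha, hb, hla, hlb⟩ := h
  refine ⟨mul_pos hγ hM, ?_, ?_, ?_, ?_, ?_⟩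
  · rintro (_ | i)
    · rw [npr_zero]; exact npr_m3 hr.le (hle _)
    · exact (npr_le ..).trans (max_le (npr_m3 le_rfl (hle _)) (npr_m3 hr.le (hle _)))
  · rw [npr_eq_l, ha]
    rw [ha]; exact npr_m1 hr (hle _) hM
  · rw [npr_eq_l, hb]
    rw [hb]; exact npr_m1 hr (hle _) hM
  · rintro (_ | i) hi
    · rw [npr_zero]; exact npr_m1 hr (hle _) hM
    · exact (npr_le ..).trans_lt (max_lt (npr_m2 le_rfl (hla _ (by omega)) hγ)
        (npr_m1 hr (hle _) hM))
  · rintro (_ | i) hi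
    · omega
    · exact (npr_le ..).trans_lt (max_lt (npr_m2 le_rfl (hlb _ (by omega)) hγ)
        (npr_m1 hr (hle _) hM))

lemma npr_gt (v : Valuation K Γ₀) (γ : Γ₀) (hγ : 0 < γ) (p : K[X]) (r : K) (a b : ℕ) (M : Γ₀)
    (h : nprP v γ p a b M) (hr : γ < v r) :
    nprP v γ ((X - C r) * p) a b (v r * M) := by
  obtain ⟨hM, hle, ha, hb, hla, hlb⟩ := h
  have hr0 : 0 < v r := hγ.trans hr
  have key : ∀ i, nprU v γ p i = M → nprU v γ ((X - C r) * p) i = v r * M := by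
    rintro (_ | i) hi
    · rw [npr_zero, hi]
    · rw [npr_eq_r, hi]
      rw [hi]; exact npr_m1 hr (hle _) hM
  have key2 : ∀ i, nprU v γ p i < M → nprU v γ ((X - C r) * p) i < v r * M := by
    rintro (_ | i) hi
    · rw [npr_zero]; exact npr_m2 le_rfl hi hr0
    · exact (npr_le ..).trans_lt (max_lt (npr_m1 hr (hle _) hM) (npr_m2 le_rfl hi hr0))
  refine ⟨mul_pos hr0 hM, ?_, key _ ha, key _ hb, fun i hi => key2 _ (hla i hi),
    fun i hi => key2 _ (hlb i hi)⟩
  intro i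
  rcases (hle i).lt_or_eq with h | h
  · exact (key2 i h).le
  · exact (key i h).le

lemma npr_eq (v : Valuation K Γ₀) (γ : Γ₀) (hγ : 0 < γ) (p : K[X]) (r : K) (a b : ℕ) (M : Γ₀)
    (h : nprP v γ p a b M) (hr : v r = γ) :
    nprP v γ ((X - C r) * p) a (b+1) (γ * M) := by
  obtain ⟨hM, hle, ha, hb, hla, hlb⟩ := h
  refine ⟨mul_pos hγ hM, ?_, ?_, ?_, ?_, ?_⟩
  · rintro (_ | i)
    · rw [npr_zero]; exact npr_m3 hr.le (hle _)
    · exact (npr_le ..).trans (max_le (npr_m3 le_rfl (hle _)) (npr_m3 hr.le (hle _)))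
  · rcases a with _ | a
    · rw [npr_zero, ha, hr]
    · rw [npr_eq_r, ha, hr]
      rw [ha]; exact npr_m2 hr.ge (hla _ (by omega)) (hr ▸ hγ)
  · rw [npr_eq_l, hb]
    rw [hb]; exact npr_m2 hr.le (hlb _ (by omega)) hγ
  · rintro (_ | i) hi
    · rw [npr_zero]; exact npr_m2 hr.le (hla _ hi) hγ
    · exact (npr_le ..).trans_lt (max_lt (npr_m2 le_rfl (hla _ (by omega)) hγ)
        (npr_m2 hr.le (hla _ hi) hγ))
  · rintro (_ | i) hi
    · omega
    · exact (npr_le ..).trans_lt (max_lt (npr_m2 le_rfl (hlb _ (by omega)) hγ)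
        (npr_m2 hr.le (hlb _ (by omega)) hγ))

lemma npr_main (v : Valuation K Γ₀) (γ : Γ₀) (hγ : 0 < γ) (c : K) (hc : c ≠ 0)
    (s : Multiset K) :
    ∃ a M, nprP v γ (C c * (s.map (fun r => X - C r)).prod) a
      (a + (s.filter (fun r => v r = γ)).card) M := by
  induction s using Multiset.induction_on with
  | empty =>
    refine ⟨0, v c, ?_⟩
    have h0 : 0 < v c := zero_lt_iff.2 (by simpa using hc)
    have hi : ∀ i, 0 < i → nprU v γ (C c) i = 0 := fun i hi => by
      simp [nprU, coeff_C, hi.ne']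
    have h1 : nprU v γ (C c) 0 = v c := by simp [nprU]
    simp only [Multiset.map_zero, Multiset.prod_zero, mul_one, Multiset.filter_zero,
      Multiset.card_zero, add_zero]
    refine ⟨h0, ?_, h1, h1, fun i hi => by omega, fun i h => by rw [hi i h]; exact h0⟩
    rintro (_ | i)
    · exact h1.le
    · rw [hi _ (by omega)]; exact h0.le
  | cons r s ih =>
    obtain ⟨a, M, h⟩ := ih
    rw [Multiset.map_cons, Multiset.prod_cons, mul_left_comm]
    rcases lt_trichotomy (v r) γ with hr | hr | hr
    · refine ⟨a + 1, γ * M, ?_⟩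
      rw [Multiset.filter_cons_of_neg (p := fun r => v r = γ) (a := r) _ hr.ne, add_right_comm]
      exact npr_lt v γ hγ _ r _ _ M h hr
    · refine ⟨a, γ * M, ?_⟩
      rw [Multiset.filter_cons_of_pos (p := fun r => v r = γ) (a := r) _ hr, Multiset.card_cons, ← add_assoc]
      exact npr_eq v γ hγ _ r _ _ M h hr
    · refine ⟨a, v r * M, ?_⟩
      rw [Multiset.filter_cons_of_neg (p := fun r => v r = γ) (a := r) _ hr.ne']
      exact npr_gt v γ hγ _ r _ _ M h hr

end NPR

/-- Newton's polygon rule: over an algebraically closed valued field, the number of roots of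
valuation `γ` of a nonzero polynomial `f`, counted with multiplicity, equals the horizontal
width `max S - min S` of the set `S` of indices `i` maximizing `v (coeff f i) * γ ^ i`. -/
theorem newton_polygon_rule
    {K : Type*} [Field K] [IsAlgClosed K] {Γ₀ : Type*} [LinearOrderedCommGroupWithZero Γ₀]
    (v : Valuation K Γ₀) (f : K[X]) (hf : f ≠ 0) (γ : Γ₀) (hγ : γ ≠ 0)
    (hS : (f.support.filter (fun i => ∀ j ∈ f.support,
        v (f.coeff j) * γ ^ j ≤ v (f.coeff i) * γ ^ i)).Nonempty) :
    (f.roots.filter (fun r => v r = γ)).card =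
      (f.support.filter (fun i => ∀ j ∈ f.support,
          v (f.coeff j) * γ ^ j ≤ v (f.coeff i) * γ ^ i)).max' hS -
        (f.support.filter (fun i => ∀ j ∈ f.support,
          v (f.coeff j) * γ ^ j ≤ v (f.coeff i) * γ ^ i)).min' hS := by
  have hγ' : 0 < γ := zero_lt_iff.2 hγ
  obtain ⟨a, M, h⟩ := npr_main v γ hγ' f.leadingCoeff (leadingCoeff_ne_zero.2 hf) f.roots
  rw [← (IsAlgClosed.splits f).eq_prod_roots] at h
  obtain ⟨hM, hle, ha, hb, hla, hlb⟩ := h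
  set n := (f.roots.filter (fun r => v r = γ)).card
  have hsupp : ∀ i, nprU v γ f i = M → i ∈ f.support := fun i hi => by
    rw [mem_support_iff]; intro h0
    rw [nprU, h0, map_zero, zero_mul] at hi
    exact hM.ne hi
  have hmem : ∀ i, i ∈ (f.support.filter (fun i => ∀ j ∈ f.support,
      v (f.coeff j) * γ ^ j ≤ v (f.coeff i) * γ ^ i)) ↔ nprU v γ f i = M := fun i => by
    rw [Finset.mem_filter]
    constructor
    · rintro ⟨_, h⟩
      refine le_antisymm (hle i) ?_
      rw [← ha]; exact h a (hsupp a ha)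
    · intro hi
      refine ⟨hsupp i hi, fun j _ => ?_⟩
      exact (hle j).trans hi.ge
  generalize (f.support.filter (fun i => ∀ j ∈ f.support,
      v (f.coeff j) * γ ^ j ≤ v (f.coeff i) * γ ^ i)) = S at hS hmem ⊢
  have h1 : S.max' hS = a + n := by
    refine le_antisymm (Finset.max'_le _ _ _ fun i hi => ?_) (Finset.le_max' _ _ ((hmem _).2 hb))
    by_contra! hlt
    exact (hlb i hlt).ne ((hmem i).1 hi)
  have h2 : S.min' hS = a := by
    refine le_antisymm (Finset.min'_le _ _ ((hmem _).2 ha)) (Finset.le_min' _ _ _ fun i hi => ?_)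
    by_contra! hlt
    exact (hla i hlt).ne ((hmem i).1 hi)
  rw [h1, h2]; omega
end

section
/- Let θ ∈ ℝ with 0 < θ < 2π. There exist positive real numbers r₀, r₁, r₂ with r₀ + r₁·e^{iθ} + r₂·e^{2iθ} = 0 if and only if π/2 < θ < 3π/2. -/
/-- `e^{iθ}` is a root of `x² + x + 1` over the phase hyperfield, i.e. there are positive
reals `r₀, r₁, r₂` with `r₀ + r₁·e^{iθ} + r₂·e^{2iθ} = 0`, if and only if
`π/2 < θ < 3π/2` (for `0 < θ < 2π`). -/
theorem phase_root_of_quadratic_iff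
    (θ : ℝ) (h1 : 0 < θ) (h2 : θ < 2 * Real.pi) :
    (∃ r₀ r₁ r₂ : ℝ, 0 < r₀ ∧ 0 < r₁ ∧ 0 < r₂ ∧
        (r₀ : ℂ) + (r₁ : ℂ) * Complex.exp (θ * Complex.I) +
          (r₂ : ℂ) * Complex.exp (2 * θ * Complex.I) = 0) ↔
      (Real.pi / 2 < θ ∧ θ < 3 * Real.pi / 2) := by
  have he : Complex.exp (θ * Complex.I) = ((Real.cos θ : ℝ) : ℂ) + ((Real.sin θ : ℝ) : ℂ) * Complex.I := by
    rw [Complex.exp_mul_I]; push_cast; rfl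
  have he2 : Complex.exp (2 * θ * Complex.I) = Complex.exp (θ * Complex.I) ^ 2 := by
    rw [← Complex.exp_nat_mul]; congr 1; push_cast; ring
  have hsc := Real.sin_sq_add_cos_sq θ
  rw [he2, he]
  constructor
  · rintro ⟨a, b, d, ha, hb, hd, h⟩
    by_contra hcon
    have hc : 0 ≤ Real.cos θ := by
      by_cases hθ : Real.pi / 2 < θ
      · have h3 : 3 * Real.pi / 2 ≤ θ := by
          by_contra h4
          exact hcon ⟨hθ, not_le.mp h4⟩
        rw [← Real.cos_sub_two_pi]
        exact Real.cos_nonneg_of_neg_pi_div_two_le_of_le (by linarith) (by linarith)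
      · exact Real.cos_nonneg_of_neg_pi_div_two_le_of_le (by linarith) (by linarith)
    have hre := congrArg Complex.re h
    have him := congrArg Complex.im h
    simp only [pow_two, Complex.add_re, Complex.mul_re, Complex.add_im, Complex.mul_im,
      Complex.ofReal_re, Complex.ofReal_im, Complex.I_re, Complex.I_im, Complex.zero_re,
      Complex.zero_im] at hre him
    generalize Real.cos θ = c at *
    generalize Real.sin θ = s at *
    have hs : s * (b + 2 * d * c) = 0 := by linarith
    have hpos : 0 < b + 2 * d * c := by positivity
    have hs0 : s = 0 := (mul_eq_zero.mp hs).resolve_right hpos.ne'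
    subst hs0
    have : 0 < a + b * c + d * (c * c) := by positivity
    linarith
  · rintro ⟨h3, h4⟩
    have hc : Real.cos θ < 0 :=
      Real.cos_neg_of_pi_div_two_lt_of_lt h3 (by linarith)
    refine ⟨1, -2 * Real.cos θ, 1, one_pos, by linarith, one_pos, ?_⟩
    have hsc' : ((Real.sin θ : ℝ) : ℂ) ^ 2 + ((Real.cos θ : ℝ) : ℂ) ^ 2 = 1 := by
      exact_mod_cast hsc
    rw [Complex.ofReal_mul, Complex.ofReal_neg, Complex.ofReal_ofNat, Complex.ofReal_one]
    linear_combination (-1 : ℂ) * hsc' + ((Real.sin θ : ℝ) : ℂ) ^ 2 * Complex.I_sq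
end
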